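/- Let σ : ℝ → ℝ be any continuous function, let d ≥ 2 be a natural number, and let K ⊂ ℝ^d be a compact set with nonempty interior. Then for every sequence of real numbers (ε_n)_{n≥1} with ε_n → 0 there exists a continuous function f : K → ℝ such that for every n ≥ 1, inf_{g ∈ Σ_n^{σ,d}} sup_{x ∈ K} |f(x) − g(x)| ≥ ε_n. -/

import Mathlib

open MeasureTheory

/-- `SigmaNet σ n d` is the set `Σ_n^{σ,d}` of functions on `ℝ^d` computed by a feedforward
neural network with one hidden layer of `n` units and activation function `σ`. -/
def SigmaNet (σ : ℝ → ℝ) (n d : ℕ) : Set ((Fin d → ℝ) → ℝ) :=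
  { f | ∃ (w : Fin n → Fin d → ℝ) (c b : Fin n → ℝ),
      f = fun x => ∑ k, c k * σ ((∑ i, w k i * x i) - b k) }

open Filter Topology

/-- vertices -/
noncomputable def pvert {E : Type*} [NormedAddCommGroup E] [NormedSpace ℝ E] {n : ℕ}
    (v : Fin n → E) (s : Fin n → Bool) : E :=
  ∑ k, if s k then ((1 / 4 : ℝ) ^ (k : ℕ)) • v k else 0

/-- signs -/
noncomputable def sgnv {n : ℕ} (s : Fin n → Bool) : ℝ := ∏ k, if s k then (-1 : ℝ) else 1

section
variable {E : Type*} [NormedAddCommGroup E] [NormedSpace ℝ E]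

lemma pvert_succ {n : ℕ} (v : Fin (n + 1) → E) (s : Fin (n + 1) → Bool) :
    pvert v s = (if s 0 then v 0 else 0)
      + (1 / 4 : ℝ) • pvert (fun k => v k.succ) (fun k => s k.succ) := by
  unfold pvert
  rw [Fin.sum_univ_succ, Finset.smul_sum]
  congr 1
  · simp
  · refine Finset.sum_congr rfl fun k _ => ?_
    split_ifs
    · rw [smul_smul, Fin.val_succ, pow_succ, mul_comm]
    · simp

lemma pvert_norm {n : ℕ} (v : Fin n → E) (hv : ∀ k, ‖v k‖ = 1) (s : Fin n → Bool) :
    ‖pvert v s‖ < 2 := by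
  induction n with
  | zero => simp [pvert]
  | succ n ih =>
    rw [pvert_succ]
    have h1 := ih (fun k => v k.succ) (fun k => hv _) (fun k => s k.succ)
    have h2 : ‖(if s 0 then v 0 else 0)‖ ≤ 1 := by
      split_ifs
      · exact (hv 0).le
      · simp
    refine (norm_add_le _ _).trans_lt ?_
    rw [norm_smul, Real.norm_of_nonneg (by norm_num)]
    linarith

lemma pvert_inj {n : ℕ} (v : Fin n → E) (hv : ∀ k, ‖v k‖ = 1) :
    Function.Injective (pvert v) := by
  induction n with
  | zero => intro s t _; exact Subsingleton.elim _ _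
  | succ n ih =>
    have key : ∀ s t : Fin (n + 1) → Bool, s 0 = true → t 0 = false → pvert v s ≠ pvert v t := by
      intro s t hs ht h
      rw [pvert_succ, pvert_succ, hs, ht] at h
      have h1 := pvert_norm (fun k => v k.succ) (fun k => hv _) (fun k => s k.succ)
      have h2 := pvert_norm (fun k => v k.succ) (fun k => hv _) (fun k => t k.succ)
      set a := pvert (fun k => v k.succ) (fun k => s k.succ)
      set b := pvert (fun k => v k.succ) (fun k => t k.succ)
      have h3 : v 0 = (1 / 4 : ℝ) • (b - a) := by
        simp only [if_true, zero_add, Bool.false_eq_true, if_false] at h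
        rw [smul_sub, ← h]; abel
      have h4 := hv 0
      rw [h3, norm_smul, Real.norm_of_nonneg (by norm_num)] at h4
      have := norm_sub_le b a
      linarith
    intro s t h
    have h0 : s 0 = t 0 := by
      cases hs : s 0 <;> cases ht : t 0
      · rfl
      · exact absurd h.symm (key t s ht hs)
      · exact absurd h (key s t hs ht)
      · rfl
    rw [pvert_succ, pvert_succ, h0, add_right_inj] at h
    have h1 := smul_right_injective E (by norm_num : (1 / 4 : ℝ) ≠ 0) h
    have h2 := ih (fun k => v k.succ) (fun k => hv _) h1
    funext k
    refine Fin.cases h0 (fun j => congrFun h2 j) k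

lemma pvert_cont {n : ℕ} (s : Fin n → Bool) : Continuous fun v : Fin n → E => pvert v s := by
  unfold pvert
  refine continuous_finsetSum _ fun k _ => ?_
  split_ifs
  · fun_prop
  · fun_prop

lemma sgnv_cases {n : ℕ} (s : Fin n → Bool) : sgnv s = 1 ∨ sgnv s = -1 := by
  unfold sgnv
  refine Finset.prod_induction _ (fun x : ℝ => x = 1 ∨ x = -1) ?_ (Or.inl rfl) ?_
  · rintro a b (rfl | rfl) (rfl | rfl) <;> simp
  · intro k _; split_ifs <;> simp

lemma sgnv_update {n : ℕ} (s : Fin n → Bool) (k : Fin n) :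
    sgnv (Function.update s k (!s k)) = - sgnv s := by
  unfold sgnv
  rw [← Finset.mul_prod_erase _ _ (Finset.mem_univ k),
    ← Finset.mul_prod_erase (a := k) (f := fun k => if s k then (-1 : ℝ) else 1) _ (Finset.mem_univ k)]
  rw [Finset.prod_congr rfl (g := fun k => if s k then (-1 : ℝ) else 1)]
  · cases h : s k <;> simp
  · intro j hj
    rw [Function.update_of_ne (Finset.ne_of_mem_erase hj)]

lemma annih {n : ℕ} (v : Fin n → E) (k : Fin n) (L : E →ₗ[ℝ] ℝ) (hL : L (v k) = 0)
    (x : E) (r : ℝ) (h : ℝ → ℝ) :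
    ∑ s : Fin n → Bool, sgnv s * h (L (x + r • pvert v s)) = 0 := by
  refine Finset.sum_ninvolution (fun s => Function.update s k (!s k)) ?_ ?_ ?_ ?_
  · intro s
    have : L (pvert v (Function.update s k (!s k))) = L (pvert v s) := by
      unfold pvert
      rw [map_sum, map_sum]
      refine Finset.sum_congr rfl fun j _ => ?_
      by_cases hj : j = k
      · subst hj; split_ifs <;> simp [hL]
      · rw [Function.update_of_ne hj]
    simp only [map_add, map_smul, this, sgnv_update]; ring
  · intro s _ h
    have := congrFun h k
    simp at this
  · intro s; simp
  · intro s; simp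

/-- good on a set of direction tuples -/
def GoodOn (n : ℕ) (V : Set (Fin n → E)) : Prop :=
  ∃ (F : E → ℝ) (R : ℝ), 0 < R ∧ Continuous F ∧ (∀ y, |F y| ≤ 1) ∧ (∀ y, R ≤ ‖y‖ → F y = 0) ∧
    ∀ v ∈ V, ∃ x, ∀ s, F (x + pvert v s) = sgnv s

lemma good_union [Nontrivial E] {n : ℕ} {V W : Set (Fin n → E)} (hV : GoodOn n V)
    (hW : GoodOn n W) : GoodOn n (V ∪ W) := by
  obtain ⟨F, R, hR, hF, hF1, hF0, hFv⟩ := hV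
  obtain ⟨G, S, hS, hG, hG1, hG0, hGv⟩ := hW
  obtain ⟨c, hc⟩ := NormedSpace.exists_lt_norm ℝ E (R + S)
  have disj : ∀ y, F y = 0 ∨ G (y - c) = 0 := by
    intro y
    by_cases h : R ≤ ‖y‖
    · exact Or.inl (hF0 y h)
    · right
      apply hG0
      have := norm_sub_norm_le c y
      rw [norm_sub_rev] at this
      push Not at h
      linarith
  have sne : ∀ s : Fin n → Bool, sgnv s ≠ 0 := by
    intro s; rcases sgnv_cases s with h | h <;> rw [h] <;> norm_num
  refine ⟨fun y => F y + G (y - c), R + S + ‖c‖, by positivity, by fun_prop, ?_, ?_, ?_⟩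
  · intro y
    rcases disj y with h | h
    · simpa [h] using hG1 _
    · simpa [h] using hF1 _
  · intro y hy
    have := norm_sub_norm_le y c
    have := norm_nonneg c
    simp only
    rw [hF0 y (by linarith), hG0 _ (by linarith), add_zero]
  · rintro v (hv | hv)
    · obtain ⟨x, hx⟩ := hFv v hv
      refine ⟨x, fun s => ?_⟩
      have := disj (x + pvert v s)
      rw [hx s] at this
      simp only
      rw [hx s, this.resolve_left (sne s), add_zero]
    · obtain ⟨x, hx⟩ := hGv v hv
      refine ⟨x + c, fun s => ?_⟩
      have e : x + c + pvert v s - c = x + pvert v s := by abel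
      have := disj (x + c + pvert v s)
      rw [e, hx s] at this
      simp only
      rw [e, hx s, this.resolve_right (sne s), zero_add]

lemma good_local {n : ℕ} (v : Fin n → E) (hv : ∀ k, ‖v k‖ = 1) :
    ∃ U ∈ 𝓝 v, GoodOn n U := by
  have hcl : IsClosedEmbedding (pvert v) :=
    (continuous_of_discreteTopology).isClosedEmbedding (pvert_inj v hv)
  obtain ⟨G, hG⟩ := ContinuousMap.exists_extension hcl
    (⟨fun s => 2 * sgnv s, continuous_of_discreteTopology⟩ : C(Fin n → Bool, ℝ))
  have hG' : ∀ s, G (pvert v s) = 2 * sgnv s := fun s => DFunLike.congr_fun hG s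
  let F : E → ℝ := fun y => max (-1) (min 1 (G y)) * max 0 (min 1 (3 - ‖y‖))
  refine ⟨{u | ∀ s, 1 < sgnv s * G (pvert u s) ∧ ‖pvert u s‖ < 2}, ?_, F, 3, by norm_num, ?_, ?_, ?_, ?_⟩
  · refine IsOpen.mem_nhds ?_ ?_
    · simp only [Set.ofPred_forall, Set.ofPred_and]
      refine isOpen_iInter_of_finite fun s => ?_
      have := pvert_cont (E := E) s
      exact (isOpen_lt continuous_const (by fun_prop)).inter (isOpen_lt (by fun_prop) continuous_const)
    · intro s
      refine ⟨?_, pvert_norm v hv s⟩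
      rw [hG']
      rcases sgnv_cases s with h | h <;> rw [h] <;> norm_num
  · fun_prop
  · intro y
    simp only [F, abs_mul]
    refine mul_le_one₀ ?_ (abs_nonneg _) ?_
    · rw [abs_le]; constructor
      · exact le_max_left _ _
      · exact max_le (by norm_num) (min_le_left _ _)
    · rw [abs_le]; constructor
      · exact le_trans (by norm_num) (le_max_left _ _)
      · exact max_le (by norm_num) (min_le_left _ _)
  · intro y hy
    simp only [F]
    rw [max_eq_left (a := (0:ℝ)), mul_zero]
    exact (min_le_right _ _).trans (by linarith)
  · intro u hu
    refine ⟨0, fun s => ?_⟩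
    obtain ⟨h1, h2⟩ := hu s
    simp only [F, zero_add]
    rw [min_eq_left (a := (1:ℝ)) (b := 3 - _) (by linarith), max_eq_right (a := (0:ℝ)) (by norm_num), mul_one]
    rcases sgnv_cases s with h | h <;> rw [h] at h1 ⊢
    · rw [min_eq_left (by linarith)]; norm_num
    · rw [max_eq_left]
      exact (min_le_right _ _).trans (by linarith)

lemma good_all [Nontrivial E] [ProperSpace E] (n : ℕ) :
    GoodOn n {v : Fin n → E | ∀ k, ‖v k‖ = 1} := by
  have hc : IsCompact {v : Fin n → E | ∀ k, ‖v k‖ = 1} := by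
    have := isCompact_univ_pi (fun _ : Fin n => isCompact_sphere (0 : E) 1)
    convert this using 1
    ext v; simp
  refine hc.induction_on (p := GoodOn n) ?_ ?_ ?_ ?_
  · exact ⟨fun _ => 0, 1, one_pos, continuous_const, by simp, by simp, by simp⟩
  · rintro s t hst ⟨F, R, hR, h1, h2, h3, h4⟩
    exact ⟨F, R, hR, h1, h2, h3, fun v hv => h4 v (hst hv)⟩
  · intro s t; exact good_union
  · intro v hv
    obtain ⟨U, hU, h⟩ := good_local v hv
    exact ⟨U, mem_nhdsWithin_of_mem_nhds hU, h⟩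

lemma good_scaled [Nontrivial E] [ProperSpace E] (n : ℕ) (U : Set E) (hU : IsOpen U)
    (hne : U.Nonempty) : ∃ G : E → ℝ, Continuous G ∧ (∀ y, |G y| ≤ 1) ∧ (∀ y, y ∉ U → G y = 0) ∧
      ∀ v : Fin n → E, (∀ k, ‖v k‖ = 1) → ∃ (x : E) (r : ℝ), ∀ s, G (x + r • pvert v s) = sgnv s := by
  obtain ⟨c, hc⟩ := hne
  obtain ⟨ρ, hρ, hb⟩ := Metric.isOpen_iff.1 hU c hc
  obtain ⟨F, R, hR, h1, h2, h3, h4⟩ := good_all (E := E) n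
  refine ⟨fun y => F ((R / ρ) • (y - c)), by fun_prop, fun y => h2 _, ?_, ?_⟩
  · intro y hy
    apply h3
    have : ρ ≤ ‖y - c‖ := by
      by_contra! h
      exact hy (hb (by simpa [dist_eq_norm] using h))
    rw [norm_smul, Real.norm_of_nonneg (by positivity), div_mul_eq_mul_div, le_div_iff₀ hρ]
    gcongr
  · intro v hv
    obtain ⟨x, hx⟩ := h4 v hv
    refine ⟨c + (ρ / R) • x, ρ / R, fun s => ?_⟩
    simp only
    rw [← hx s]
    congr 1
    rw [add_assoc, add_sub_cancel_left, ← smul_add, smul_smul, div_mul_div_cancel₀ hρ.ne', div_self hR.ne', one_smul]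

lemma glue (U : ℕ → Set E) (hd : Pairwise (Function.onFun Disjoint U)) (ε : ℕ → ℝ)
    (hε : Tendsto ε atTop (𝓝 0)) (G : ℕ → E → ℝ) (hG : ∀ n, Continuous (G n))
    (hG1 : ∀ n y, |G n y| ≤ 1) (hG0 : ∀ n y, y ∉ U n → G n y = 0) :
    ∃ f : E → ℝ, Continuous f ∧ ∀ n y, G n y ≠ 0 → f y = ε n * G n y := by
  have hz : ∀ n y, G n y ≠ 0 → ∀ m, m ≠ n → G m y = 0 := by
    intro n y h m hm
    apply hG0
    intro hy
    have hy' : y ∈ U n := by by_contra h'; exact h (hG0 n y h')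
    exact Set.disjoint_left.1 (hd hm) hy hy'
  let f : E → ℝ := fun y => ∑' n, ε n * G n y
  have hf : ∀ n y, G n y ≠ 0 → f y = ε n * G n y := by
    intro n y h
    exact tsum_eq_single n fun m hm => by rw [hz n y h m hm, mul_zero]
  refine ⟨f, ?_, hf⟩
  refine continuous_of_uniform_approx_of_continuous fun u hu => ?_
  obtain ⟨η, hη, hu⟩ := Metric.mem_uniformity_dist.1 hu
  obtain ⟨N, hN⟩ := Metric.tendsto_atTop.1 hε η hη
  refine ⟨fun y => ∑ n ∈ Finset.range N, ε n * G n y, by fun_prop, fun y => hu ?_⟩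
  by_cases h : ∃ n, G n y ≠ 0
  · obtain ⟨n, h⟩ := h
    rw [hf n y h]
    beta_reduce
    by_cases hn : n < N
    · rw [Finset.sum_eq_single n, dist_self]
      · exact hη
      · intro m _ hm; rw [hz n y h m hm, mul_zero]
      · intro h'; simp [hn] at h'
    · rw [Finset.sum_eq_zero]
      · have h1 := hN n (not_lt.1 hn)
        rw [Real.dist_eq, sub_zero] at h1 ⊢
        rw [abs_mul]
        nlinarith [hG1 n y, abs_nonneg (ε n), abs_nonneg (G n y)]
      · intro m hm
        rw [hz n y h m, mul_zero]
        rintro rfl; exact hn (Finset.mem_range.1 hm)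
  · push Not at h
    simp [f, h, hη]

lemma exists_disj [Nontrivial E] (O : Set E) (hO : IsOpen O) (hne : O.Nonempty) :
    ∃ U : ℕ → Set E, (∀ n, IsOpen (U n) ∧ (U n).Nonempty ∧ U n ⊆ O) ∧
      Pairwise (Function.onFun Disjoint U) := by
  obtain ⟨c, hc⟩ := hne
  have : Infinite O := (infinite_of_mem_nhds (X := E) c (hO.mem_nhds hc)).to_subtype
  obtain ⟨U, h1, h2, h3⟩ := exists_seq_infinite_isOpen_pairwise_disjoint O
  refine ⟨fun n => Subtype.val '' U n, fun n => ⟨hO.isOpenMap_subtype_val _ (h2 n), (h1 n).nonempty.image _, by simp⟩, ?_⟩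
  intro m n hmn
  exact (Set.disjoint_image_iff Subtype.val_injective).2 (h3 hmn)

end

lemma exists_perp {d : ℕ} (hd : 2 ≤ d) (w : Fin d → ℝ) :
    ∃ v : Fin d → ℝ, ‖v‖ = 1 ∧ ∑ i, w i * v i = 0 := by
  suffices h : ∃ v : Fin d → ℝ, v ≠ 0 ∧ ∑ i, w i * v i = 0 by
    obtain ⟨v, hv, h⟩ := h
    refine ⟨‖v‖⁻¹ • v, by
      rw [norm_smul, norm_inv, norm_norm, inv_mul_cancel₀ (norm_ne_zero_iff.2 hv)], ?_⟩
    have e : ∀ i, w i * (‖v‖⁻¹ • v) i = ‖v‖⁻¹ * (w i * v i) := by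
      intro i
      rw [Pi.smul_apply, smul_eq_mul]
      ring
    rw [Finset.sum_congr rfl fun i _ => e i, ← Finset.mul_sum, h, mul_zero]
  let L : (Fin d → ℝ) →ₗ[ℝ] ℝ := Fintype.linearCombination ℝ w
  have hk : LinearMap.ker L ≠ ⊥ := by
    apply LinearMap.ker_ne_bot_of_finrank_lt
    simp; omega
  obtain ⟨v, hv, hv0⟩ := Submodule.exists_mem_ne_zero_of_ne_bot hk
  refine ⟨v, hv0, ?_⟩
  simpa [L, Fintype.linearCombination_apply, mul_comm] using hv

/-- For any continuous activation `σ`, any `d ≥ 2` and any compact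
`K ⊂ ℝ^d` with nonempty interior, and for any null sequence `(ε_n)`, there is a continuous
function `f` on `K` with `inf_{g ∈ Σ_n^{σ,d}} sup_{x ∈ K} |f x - g x| ≥ ε_n` for all `n ≥ 1`. -/
theorem shallow_negative_uniform (σ : ℝ → ℝ) (hσ : Continuous σ) (d : ℕ) (hd : 2 ≤ d)
    (K : Set (Fin d → ℝ)) (hK : IsCompact K) (hKint : (interior K).Nonempty)
    (ε : ℕ → ℝ) (hε : Filter.Tendsto ε Filter.atTop (nhds 0)) :
    ∃ f : (Fin d → ℝ) → ℝ, ContinuousOn f K ∧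
      ∀ n : ℕ, 1 ≤ n → ∀ g ∈ SigmaNet σ n d,
        ε n ≤ sSup ((fun x => |f x - g x|) '' K) := by
  have hne : Nonempty (Fin d) := ⟨⟨0, by omega⟩⟩
  obtain ⟨U, hU, hUd⟩ := exists_disj (interior K) isOpen_interior hKint
  choose G hG hG1 hG0 hGv using fun n => good_scaled n (U n) (hU n).1 (hU n).2.1
  obtain ⟨f, hf, hfe⟩ := glue U hUd ε hε G hG hG1 hG0
  refine ⟨f, hf.continuousOn, ?_⟩
  rintro n - g ⟨w, c, b, rfl⟩
  set g : (Fin d → ℝ) → ℝ := fun x => ∑ k, c k * σ ((∑ i, w k i * x i) - b k) with hg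
  have hgc : Continuous g := by
    refine continuous_finsetSum _ fun k _ => continuous_const.mul (hσ.comp ?_)
    fun_prop
  have hb : BddAbove ((fun x => |f x - g x|) '' K) :=
    (hK.image (by fun_prop)).bddAbove
  set M := sSup ((fun x => |f x - g x|) '' K) with hM
  choose v hv hwv using fun k => exists_perp hd (w k)
  obtain ⟨x, r, hx⟩ := hGv n v hv
  have sne : ∀ s : Fin n → Bool, sgnv s ≠ 0 := by
    intro s; rcases sgnv_cases s with h | h <;> rw [h] <;> norm_num
  have hpt : ∀ s, sgnv s * (f (x + r • pvert v s) - g (x + r • pvert v s)) ≤ M := by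
    intro s
    have hnz : G n (x + r • pvert v s) ≠ 0 := by rw [hx s]; exact sne s
    have hK' : x + r • pvert v s ∈ K := by
      apply interior_subset
      apply (hU n).2.2
      by_contra h
      exact hnz (hG0 n _ h)
    have h1 : |f (x + r • pvert v s) - g (x + r • pvert v s)| ≤ M :=
      le_csSup hb ⟨_, hK', rfl⟩
    refine le_trans (le_abs_self _) ?_
    rw [abs_mul]
    rcases sgnv_cases s with h | h <;> rw [h] <;> simpa using h1
  have hfs : ∀ s, sgnv s * f (x + r • pvert v s) = ε n := by
    intro s
    rw [hfe n _ (by rw [hx s]; exact sne s), hx s]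
    rcases sgnv_cases s with h | h <;> rw [h] <;> ring
  have hgs : ∑ s, sgnv s * g (x + r • pvert v s) = 0 := by
    simp only [hg, Finset.mul_sum]
    rw [Finset.sum_comm]
    refine Finset.sum_eq_zero fun k _ => ?_
    have h := annih v k (Fintype.linearCombination ℝ (w k))
      (by simpa [Fintype.linearCombination_apply, mul_comm] using hwv k) x r
      (fun t => c k * σ (t - b k))
    simpa [Fintype.linearCombination_apply, mul_comm] using h
  have hsum := Finset.sum_le_sum (s := Finset.univ) fun s _ => hpt s
  simp only [mul_sub, Finset.sum_sub_distrib, hgs, hfs, sub_zero, Finset.sum_const, nsmul_eq_mul] at hsum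
  refine le_of_mul_le_mul_left hsum ?_
  simp
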